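/- Polynomiality of the Tratnik polynomials of q-Racah type: for all nonnegative integers i, j with i+j ≤ N, there exists a bivariate polynomial P ∈ ℂ[X,Y] of total degree N−i such that for all nonnegative integers x, y with x+y ≤ N one has T_{i,j}(x,y;c₁,c₂,c₃,c₄;N) = T_{N,0}(x,y;c₁,c₂,c₃,c₄;N)·P(λ(x;c₁c₂), λ(y;c₃c₀)), where T_{N,0}(x,y;c₁,c₂,c₃,c₄;N) = (−1)^N (c₁/c₄)^{N/2}·ξ_N(c₂, c₂c₃q^N)·(c₄/c₃)^{x/2}·ξ_x(c₁,c₂), which is nonzero. -/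

import Mathlib

noncomputable section
namespace qR

/-- q-Pochhammer symbol `(a;q)_k = ∏_{l<k} (1 - a qˡ)`. -/
def poch (q a : ℂ) (k : ℕ) : ℂ := ∏ l ∈ Finset.range k, (1 - a * q ^ l)

/-- q-binomial coefficient, zero outside `0 ≤ n ≤ N`. -/
def binom (q : ℂ) (N n : ℤ) : ℂ :=
  if 0 ≤ n ∧ n ≤ N then poch q q N.toNat / (poch q q n.toNat * poch q q (N - n).toNat) else 0

/-- Normalisation `Ω(n;c1,c2,c3;N)`; `s` and `t2` are the chosen square roots of `q` and `c2`,
so that `(q c2)^(n - N/2) = (s t2)^(2n - N)`. -/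
def Om (q s c1 c2 c3 t2 : ℂ) (N n : ℤ) : ℂ :=
  binom q N n * (1 - c2 * c3 * q ^ (2 * n + 1)) * poch q (q * c2) n.toNat
      * poch q (c1 * c2 * c3 * q ^ (N + 2)) n.toNat * poch q (q * c1) (N - n).toNat
    / ((s * t2) ^ (2 * n - N) * poch q (c2 * c3 * q ^ (n + 1)) (N + 1).toNat
        * poch q (q * c3) n.toNat)

/-- Normalised q-Racah polynomial `p_n(x;c1,c2,c3;N)`, with the convention that it
vanishes unless `0 ≤ n ≤ N` and `0 ≤ x ≤ N`. -/
def p (q s c1 c2 c3 t2 : ℂ) (N n x : ℤ) : ℂ :=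
  if 0 ≤ n ∧ n ≤ N ∧ 0 ≤ x ∧ x ≤ N then
    Om q s c1 c2 c3 t2 N n *
      ∑ k ∈ Finset.range (n.toNat + 1),
        poch q (q ^ (-n)) k * poch q (c2 * c3 * q ^ (n + 1)) k * poch q (q ^ (-x)) k
            * poch q (c1 * c2 * q ^ (x + 1)) k * q ^ k
          / (poch q (q * c2) k * poch q (c1 * c2 * c3 * q ^ (N + 2)) k
              * poch q (q ^ (-N)) k * poch q q k)
  else 0

/-- `ω_n(c) = (-1)^n c^{n/2} q^{n(n+1)/2}`, where `r` is the chosen square root of `c`. -/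
def om (q r : ℂ) (n : ℤ) : ℂ := (-1 : ℂ) ^ n * r ^ n * q ^ (n * (n + 1) / 2)

/-- `ξ_n(c1,c2) = ((qc1;q)_n/(qc2;q)_n) (c2/c1)^{n/2}`, where `t1, t2` are the chosen
square roots of `c1, c2`. -/
def xi (q c1 c2 t1 t2 : ℂ) (n : ℤ) : ℂ :=
  poch q (q * c1) n.toNat / poch q (q * c2) n.toNat * (t2 / t1) ^ n

/-- `λ(x;c) = -(1-q^{-x})(1-c q^{x+1})`. -/
def lam (q c : ℂ) (x : ℤ) : ℂ := -(1 - q ^ (-x)) * (1 - c * q ^ (x + 1))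

def PhiP (q c1 c2 c3 : ℂ) (N n : ℤ) : ℂ :=
  -c2 * q ^ (n - N) * (1 - q ^ n) * (1 - c1 * q ^ (N - n + 1)) * (1 - c2 * c3 * q ^ (n + N + 1))
      * (1 - c3 * q ^ n)
    / ((1 - c2 * c3 * q ^ (2 * n)) * (1 - c2 * c3 * q ^ (2 * n + 1)))

def PhiM (q c1 c2 c3 : ℂ) (N n : ℤ) : ℂ :=
  (1 - q ^ (n - N)) * (1 - c1 * c2 * c3 * q ^ (n + N + 2)) * (1 - c2 * q ^ (n + 1))
      * (1 - c2 * c3 * q ^ (n + 1))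
    / ((1 - c2 * c3 * q ^ (2 * n + 1)) * (1 - c2 * c3 * q ^ (2 * n + 2)))

/-- `Φ^ε(n;c1,c2,c3;N)`, where `ε = 1, -1, 0` selects `Φ⁺, Φ⁻, Φ⁰`. -/
def Phi (q c1 c2 c3 : ℂ) (N ε n : ℤ) : ℂ :=
  if ε = 1 then PhiP q c1 c2 c3 N n
  else if ε = -1 then PhiM q c1 c2 c3 N n
  else -PhiP q c1 c2 c3 N n - PhiM q c1 c2 c3 N n

/-- `λ₊(x;c1,c2,c3;N)`. -/
def lamP (q c1 c2 c3 : ℂ) (N x : ℤ) : ℂ :=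
  -(q ^ (-N - 1) / c3 - q ^ (-x)) * (1 - c1 * c2 * c3 * q ^ (N + x + 2))

/-- `λ₋(x;c1,c2,c3;N)`. -/
def lamM (q c1 c2 c3 : ℂ) (N x : ℤ) : ℂ :=
  -(q ^ (-N) - q ^ (-x)) * (1 - c1 * c2 * q ^ (N + x + 1))

def PhiPp (q sq c1 c2 c3 : ℂ) (N n : ℤ) : ℂ :=
  -sq * c2 * q ^ (2 * n - N - 1) * (1 - q ^ n) * (1 - c1 * q ^ (N - n + 1))
      * (1 - c1 * q ^ (N + 2 - n)) * (1 - c3 * q ^ n)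
    / ((1 - c2 * c3 * q ^ (2 * n)) * (1 - c2 * c3 * q ^ (2 * n + 1)))

def PhiPm (q sq c1 c2 c3 : ℂ) (N n : ℤ) : ℂ :=
  -((1 - c1 * c2 * c3 * q ^ (n + N + 2)) * (1 - c1 * c2 * c3 * q ^ (n + N + 3))
      * (1 - c2 * q ^ (n + 1)) * (1 - c2 * c3 * q ^ (n + 1)))
    / (c3 * q ^ (N + 1) * sq * (1 - c2 * c3 * q ^ (2 * n + 1)) * (1 - c2 * c3 * q ^ (2 * n + 2)))

def PhiP0 (q sq c1 c2 c3 : ℂ) (N n : ℤ) : ℂ :=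
  -PhiPp q sq c1 c2 c3 N n - PhiPm q sq c1 c2 c3 N n
    - (1 - c1 * c2 * q ^ (N + 2)) * (1 - c1 * c2 * c3 * q ^ (N + 2)) / (c3 * q ^ (N + 1) * sq)

def PhiMp (q sq c1 c2 c3 : ℂ) (N n : ℤ) : ℂ :=
  -sq * (1 - q ^ n) * (1 - c3 * q ^ n) * (1 - c2 * c3 * q ^ (n + N))
      * (1 - c2 * c3 * q ^ (n + N + 1))
    / (q ^ N * (1 - c2 * c3 * q ^ (2 * n)) * (1 - c2 * c3 * q ^ (2 * n + 1)))

def PhiMm (q sq c1 c2 c3 : ℂ) (N n : ℤ) : ℂ :=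
  -c3 * sq * q ^ N * (1 - q ^ (n - N)) * (1 - q ^ (n - N + 1)) * (1 - c2 * q ^ (n + 1))
      * (1 - c2 * c3 * q ^ (n + 1))
    / ((1 - c2 * c3 * q ^ (2 * n + 1)) * (1 - c2 * c3 * q ^ (2 * n + 2)))

def PhiM0 (q sq c1 c2 c3 : ℂ) (N n : ℤ) : ℂ :=
  -PhiMp q sq c1 c2 c3 N n - PhiMm q sq c1 c2 c3 N n - sq * (1 - c3 * q ^ N) * (q ^ (-N) - 1)

/-- Contiguity coefficient `Φ_σ^ε(n;c1,c2,c3;N)`, where `σ = 1` is the `+` and `σ = -1`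
the `-` family, `ε ∈ {1,0,-1}` selects the superscript, and `sq` is the chosen square
root of `q c2`. -/
def PhiC (q sq c1 c2 c3 : ℂ) (σ ε N n : ℤ) : ℂ :=
  if σ = 1 then
    if ε = 1 then PhiPp q sq c1 c2 c3 N n
    else if ε = -1 then PhiPm q sq c1 c2 c3 N n
    else PhiP0 q sq c1 c2 c3 N n
  else
    if ε = 1 then PhiMp q sq c1 c2 c3 N n
    else if ε = -1 then PhiMm q sq c1 c2 c3 N n
    else PhiM0 q sq c1 c2 c3 N n

def Fp (q c1 c2 : ℂ) (x : ℤ) : ℂ :=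
  c1 * c2 ^ 2 * q ^ (x + 1) * (1 - c1 * q ^ x) * (1 - q ^ x)
    / ((1 - c1 * c2 * q ^ (2 * x)) * (1 - c1 * c2 * q ^ (2 * x + 1)))

def Fm (q c1 c2 : ℂ) (x : ℤ) : ℂ :=
  c1 * c2 * q ^ (x + 1) * (1 - c2 * q ^ (x + 1)) * (1 - c1 * c2 * q ^ (x + 1))
    / ((1 - c1 * c2 * q ^ (2 * x + 1)) * (1 - c1 * c2 * q ^ (2 * x + 2)))

/-- The coefficients `A^{ε,ε'}_{i,j}(c1,c2,c3,c4;N)` for `(ε,ε') ≠ (0,0)`;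
`t2` is the chosen square root of `c2` and the fifth parameter
`c0 = (q^{2N+3} c1 c2 c3 c4)⁻¹` is computed internally. -/
def Aaux (q s c1 c2 c3 c4 t2 : ℂ) (N ε ε' i j : ℤ) : ℂ :=
  if ε' = 1 ∨ ε' = -1 then
    -c3 * q ^ (N + 1) *
        (if ε' = 1 then Fp q c4 ((q ^ (2 * N + 3) * c1 * c2 * c3 * c4)⁻¹) j
         else Fm q c4 ((q ^ (2 * N + 3) * c1 * c2 * c3 * c4)⁻¹) j) *
        PhiC q (s * t2) c1 c2 c3 ε' ε (N - j) i
  else if ε = 1 ∨ ε = -1 then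
    c3 * q ^ (N + 1) *
        (Fp q c4 ((q ^ (2 * N + 3) * c1 * c2 * c3 * c4)⁻¹) j
          + Fm q c4 ((q ^ (2 * N + 3) * c1 * c2 * c3 * c4)⁻¹) j) *
        Phi q c1 c2 c3 (N - j) ε i
  else 0

/-- The coefficients `A^{ε,ε'}_{i,j}(c1,c2,c3,c4;N)`. -/
def A (q s c1 c2 c3 c4 t2 : ℂ) (N ε ε' i j : ℤ) : ℂ :=
  if ε = 0 ∧ ε' = 0 then
    -((1 - c3 * q ^ (N + 1 - j)) * (s * t2) / (1 - c1 * c2 * q ^ (N + 2 - j)))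
          * ∑ e ∈ ({-1, 0, 1} : Finset ℤ), Aaux q s c1 c2 c3 c4 t2 N e 1 i j
      - (1 - c1 * c2 * q ^ (N + 1 - j)) / ((1 - c3 * q ^ (N - j)) * (s * t2))
          * ∑ e ∈ ({-1, 0, 1} : Finset ℤ), Aaux q s c1 c2 c3 c4 t2 N e (-1) i j
      - ∑ e ∈ ({-1, 1} : Finset ℤ), Aaux q s c1 c2 c3 c4 t2 N e 0 i j
  else Aaux q s c1 c2 c3 c4 t2 N ε ε' i j

/-- `Λ(x;c1,c2,c3,c4;N)`; `s, t1, t2, t3, t4` are the chosen square roots of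
`q, c1, c2, c3, c4`. -/
def Lam (q s c1 c2 c3 c4 t1 t2 t3 t4 : ℂ) (N x : ℤ) : ℂ :=
  (-1 : ℂ) ^ x * binom q N x * (1 - c1 * c2 * q ^ (2 * x + 1)) * poch q (q * c2) x.toNat
      * (s * t2) ^ N * (t1 * t3 / (t2 * t4)) ^ x * q ^ (x * (x - 1) / 2)
    / (poch q (q * c1) x.toNat * poch q (q ^ (x + 1) * c1 * c2) (N + 1).toNat)

/-- Tratnik polynomial of q-Racah type `T_{i,j}(x,y;c1,c2,c3,c4;N)`; the fifth parameter
`c0 = (q^{2N+3} c1 c2 c3 c4)⁻¹` and its square root `t0 = (s^{2N+3} t1 t2 t3 t4)⁻¹`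
are computed internally. -/
def T (q s c1 c2 c3 c4 t1 t2 t3 t4 : ℂ) (N i j x y : ℤ) : ℂ :=
  if 0 ≤ i ∧ 0 ≤ j ∧ i + j ≤ N then
    p q s c1 c2 c3 t2 (N - j) i x *
      p q s c3 ((q ^ (2 * N + 3) * c1 * c2 * c3 * c4)⁻¹) c4
        ((s ^ (2 * N + 3) * t1 * t2 * t3 * t4)⁻¹) (N - x) j y
  else 0

/-- Griffiths polynomial of q-Racah type `G_{i,j}(x,y;c1,c2,c3,c4;N)`; the fifth parameter
`c0 = (q^{2N+3} c1 c2 c3 c4)⁻¹` and its square root `t0 = (s^{2N+3} t1 t2 t3 t4)⁻¹`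
are computed internally. -/
def G (q s c1 c2 c3 c4 t1 t2 t3 t4 : ℂ) (N i j x y : ℤ) : ℂ :=
  if 0 ≤ i ∧ 0 ≤ j ∧ i + j ≤ N then
    ∑ a ∈ Finset.range ((min (N - j) (N - y)).toNat + 1),
      om q (t1 * t2 * t3 / t4) (a : ℤ) * p q s c1 c2 c3 t2 (N - j) i (a : ℤ) *
        p q s c3 ((q ^ (2 * N + 3) * c1 * c2 * c3 * c4)⁻¹) c4
          ((s ^ (2 * N + 3) * t1 * t2 * t3 * t4)⁻¹) (N - (a : ℤ)) j y *
        p q s c4 c2 c1 t2 (N - y) (a : ℤ) x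
  else 0

end qR
namespace qR

lemma poch_zero (q a : ℂ) : poch q a 0 = 1 := by simp [poch]

lemma poch_succ (q a : ℂ) (k : ℕ) : poch q a (k+1) = poch q a k * (1 - a * q ^ k) := by
  simp [poch, Finset.prod_range_succ]

lemma poch_add (q a : ℂ) (m k : ℕ) : poch q a (m+k) = poch q a m * poch q (a * q ^ m) k := by
  simp only [poch, Finset.prod_range_add]
  congr 1
  apply Finset.prod_congr rfl
  intro l _
  rw [pow_add]; ring

lemma poch_succ_left (q a : ℂ) (k : ℕ) : poch q a (k+1) = (1 - a) * poch q (a * q) k := by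
  rw [add_comm, poch_add]; simp [poch]

lemma poch_ne {q a : ℂ} {k : ℕ} (h : ∀ l < k, a * q ^ l ≠ 1) : poch q a k ≠ 0 := by
  rw [poch, Finset.prod_ne_zero_iff]
  intro l hl
  rw [sub_ne_zero]
  exact fun h' => h l (Finset.mem_range.1 hl) h'.symm

lemma poch_neg_zero {q : ℂ} (hq : q ≠ 0) {n k : ℕ} (h : n < k) :
    poch q (q ^ (-(n:ℤ))) k = 0 := by
  rw [poch]
  apply Finset.prod_eq_zero (Finset.mem_range.2 h)
  rw [zpow_neg, zpow_natCast, inv_mul_cancel₀ (pow_ne_zero _ hq), sub_self]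

lemma poch_qq {q : ℂ} {n N : ℕ} (h1 : ∀ k : ℕ, 1 ≤ k → k ≤ N → q ^ k ≠ 1) (h : n ≤ N) :
    poch q q n ≠ 0 := by
  apply poch_ne
  intro l hl
  rw [← pow_succ']
  exact h1 _ (by omega) (by omega)

lemma poch_negN {q : ℂ} (hq : q ≠ 0) {n N k : ℕ} (h1 : ∀ k : ℕ, 1 ≤ k → k ≤ N → q ^ k ≠ 1)
    (h : k ≤ n) (hn : n ≤ N) :
    poch q (q ^ (-(n:ℤ))) k ≠ 0 := by
  apply poch_ne
  intro l hl h'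
  apply h1 (n - l) (by omega) (by omega)
  have e : n = (n - l) + l := by omega
  rw [zpow_neg, zpow_natCast] at h'
  have := pow_ne_zero n hq
  have h2 : q ^ l = q ^ n := by field_simp at h'; exact h'
  rw [e, pow_add] at h2
  have h3 := pow_ne_zero l hq
  exact mul_right_cancel₀ h3 (by rw [one_mul]; exact h2.symm)

/-- generic nonvanishing -/
def Gn (q C : ℂ) (B : ℤ) : Prop := ∀ k : ℤ, 1 ≤ k → k ≤ B → C ≠ q ^ (-k)

lemma Gn.poch {q C b : ℂ} {B : ℤ} (hq : q ≠ 0) (h : Gn q C B) (a : ℤ) (k : ℕ) (hb : b = C * q ^ a)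
    (ha : 1 ≤ a) (hk : a + k ≤ B + 1) : poch q b k ≠ 0 := by
  apply poch_ne
  intro l hl h'
  apply h (a + l) (by omega) (by omega)
  rw [hb, mul_assoc, ← zpow_natCast, ← zpow_add₀ hq] at h'
  rw [zpow_neg]
  exact eq_inv_of_mul_eq_one_left h'

lemma Gn.poch_inv {q C b : ℂ} {B : ℤ} (hq : q ≠ 0) (hC : C ≠ 0) (h : Gn q C B) (a : ℤ) (k : ℕ)
    (hb : b = q ^ (-a) / C)
    (ha : k ≤ a) (hk : a ≤ B) : qR.poch q b k ≠ 0 := by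
  apply poch_ne
  intro l hl h'
  apply h (a - l) (by omega) (by omega)
  rw [hb, div_mul_eq_mul_div, ← zpow_natCast, ← zpow_add₀ hq, div_eq_one_iff_eq hC] at h'
  rw [← h']; congr 1; ring

def F (q a b e : ℂ) (n k : ℕ) : ℂ :=
  poch q a k * poch q b k * e ^ k * poch q e (n-k) * poch q (a*b*e*q^k) (n-k)
    / (poch q q k * poch q q (n-k))

lemma saal_aux (q a b e : ℂ) (n : ℕ) (h1 : ∀ k : ℕ, 1 ≤ k → k ≤ n + 1 → q ^ k ≠ 1) (K : ℕ) :
    ∀ r, n = K + r →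
    ∑ k ∈ Finset.range (K+1), ((1 - q^(n+1)) * F q a b e (n+1) k
      - (1 - a*e*q^n)*(1-b*e*q^n) * F q a b e n k)
     = - e * q^r * (1 - a*q^K) * (1-b*q^K) * F q a b e n K := by
  have hne : ∀ k, k ≤ n + 1 → poch q q k ≠ 0 := fun k hk => poch_qq h1 hk
  have hne' : ∀ k, k ≤ n → 1 - q * q ^ k ≠ 0 := fun k hk => by
    rw [sub_ne_zero, ← pow_succ']; exact (h1 _ (by omega) (by omega)).symm
  induction K with
  | zero =>
    intro r hr
    have hr' : r = n := by omega
    subst hr'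
    simp only [zero_add, Finset.sum_range_one, F, Nat.sub_zero, poch_zero, pow_zero]
    rw [poch_succ q q r, poch_succ q e, poch_succ q (a*b*e*1)]
    have h2 := hne r (by omega)
    have h3 := hne' r (by omega)
    rw [pow_succ' q r]
    generalize poch q (a*b*e*1) r = Z
    generalize q ^ r = X at *
    field_simp
    ring
  | succ K ih =>
    intro r hr
    rw [Finset.sum_range_succ, ih (r+1) (by omega)]
    have e1 : n - K = r + 1 := by omega
    have e2 : n + 1 - (K+1) = r + 1 := by omega
    have e3 : n - (K+1) = r := by omega
    simp only [F, e1, e2, e3]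
    have h5 := hne K (by omega)
    have h6 := hne' K (by omega)
    have h7 := hne r (by omega)
    have h8 := hne' r (by omega)
    have e4 : a*b*e*q^K*q = a*b*e*q^(K+1) := by ring
    rw [poch_succ q q r, poch_succ q e, poch_succ q (a*b*e*q^(K+1)), poch_succ_left q (a*b*e*q^K), e4,
      poch_succ q q K, poch_succ q a, poch_succ q b, hr]
    generalize poch q (a*b*e*q^(K+1)) r = Z
    simp only [pow_add, pow_one]
    generalize q ^ r = X at *
    generalize q ^ K = Y at *
    have h8' : 1 - X * q ≠ 0 := by rwa [mul_comm]
    have h6' : 1 - Y * q ≠ 0 := by rwa [mul_comm]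
    field_simp
    ring

lemma saal (q a b e : ℂ) (n : ℕ) (h1 : ∀ k : ℕ, 1 ≤ k → k ≤ n → q ^ k ≠ 1) :
    ∑ k ∈ Finset.range (n+1), F q a b e n k
     = poch q (a*e) n * poch q (b*e) n / poch q q n := by
  induction n with
  | zero => simp [F, poch_zero]
  | succ n ih =>
    have hs := saal_aux q a b e n h1 n 0 rfl
    rw [Finset.sum_sub_distrib, ← Finset.mul_sum, ← Finset.mul_sum,
      ih (fun k hk hk' => h1 k hk (by omega))] at hs
    have h5 : poch q q n ≠ 0 := poch_qq h1 (by omega)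
    have h6 : 1 - q * q ^ n ≠ 0 := by
      rw [sub_ne_zero, ← pow_succ']; exact (h1 _ (by omega) (by omega)).symm
    have h7 : (1 - q^(n+1)) * ∑ k ∈ Finset.range (n+1), F q a b e (n+1) k =
      (1 - a*e*q^n)*(1-b*e*q^n) * (poch q (a * e) n * poch q (b * e) n / poch q q n)
      + - e * q^0 * (1 - a*q^n) * (1-b*q^n) * F q a b e n n := by
      rw [← hs]; ring
    rw [Finset.sum_range_succ]
    have h8 : (1 - q^(n+1)) ≠ 0 := by rw [pow_succ']; exact h6
    apply mul_left_cancel₀ h8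
    rw [mul_add, h7]
    simp only [F, Nat.sub_self, poch_zero, poch_succ]
    rw [pow_succ' q n]
    generalize q ^ n = X at *
    have h6' : 1 - X * q ≠ 0 := by rwa [mul_comm]
    field_simp
    ring

lemma poch_L1 {q : ℂ} (hq : q ≠ 0) (x k : ℕ) (h : k ≤ x) :
    poch q (q ^ (-(x:ℤ))) k * poch q q (x-k)
      = poch q q x * ∏ l ∈ Finset.range k, (-(q ^ (-(x:ℤ)) * q ^ l)) := by
  induction k with
  | zero => simp [poch_zero]
  | succ k ih =>
    have := ih (by omega)
    obtain ⟨r, rfl⟩ : ∃ r, x = k + 1 + r := ⟨x - (k+1), by omega⟩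
    have e1 : k + 1 + r - k = r + 1 := by omega
    have e2 : k + 1 + r - (k + 1) = r := by omega
    rw [e1, poch_succ] at this
    rw [e2, Finset.prod_range_succ, ← mul_assoc, ← this, poch_succ]
    have : 1 - q ^ (-((k+1+r:ℕ):ℤ)) * q ^ k = (1 - q * q ^ r) * (-(q ^ (-((k+1+r:ℕ):ℤ)) * q ^ k)) := by
      rw [zpow_neg, zpow_natCast]
      have := pow_ne_zero (k+1+r) hq
      field_simp
      ring
    rw [this]; ring

lemma poch_L2 {q s : ℂ} (hq : q ≠ 0) (hs : s ^ 2 = q) {c : ℂ} (hc : c ≠ 0) (k : ℕ) :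
    poch q (q ^ (-(k:ℤ)) / c) k = (-1/c)^k * s ^ (-((k:ℤ) * (k+1))) * poch q (q * c) k := by
  have hs0 : s ≠ 0 := by rintro rfl; simp at hs; exact hq hs.symm
  induction k with
  | zero => simp [poch_zero]
  | succ k ih =>
    have e : q ^ (-((k+1:ℕ):ℤ)) / c * q = q ^ (-(k:ℤ)) / c := by
      rw [show (-(k:ℤ)) = -((k+1:ℕ):ℤ) + 1 by push_cast; ring, zpow_add₀ hq]; simp; ring
    rw [poch_succ_left, e, ih, poch_succ]
    have e2 : s ^ (-(((k+1:ℕ):ℤ) * ((k+1:ℕ)+1))) = s ^ (-((k:ℤ) * (k+1))) * q ^ (-((k+1:ℕ):ℤ)) := by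
      rw [← hs, ← zpow_natCast s 2, ← zpow_mul, ← zpow_add₀ hs0]; congr 1; push_cast; ring
    rw [e2, zpow_neg q, zpow_natCast, pow_succ (-1/c)]
    have := pow_ne_zero (k+1) hq
    generalize (-1/c)^k = Y
    field_simp
    ring

lemma sum_ext {a b : ℕ} {f : ℕ → ℂ} (ha : ∀ k, a < k → f k = 0) (hb : ∀ k, b < k → f k = 0) :
    ∑ k ∈ Finset.range (a+1), f k = ∑ k ∈ Finset.range (b+1), f k := by
  rcases le_total a b with h | h
  · apply Finset.sum_subset
    · intro k; simp only [Finset.mem_range]; omega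
    · intro k _ h2; apply ha; simp only [Finset.mem_range] at h2; omega
  · symm
    apply Finset.sum_subset
    · intro k; simp only [Finset.mem_range]; omega
    · intro k _ h2; apply hb; simp only [Finset.mem_range] at h2; omega

end qR
namespace qR

lemma poch_ne_of_le {q a : ℂ} {m n : ℕ} (h : poch q a n ≠ 0) (hm : m ≤ n) : poch q a m ≠ 0 := by
  obtain ⟨r, rfl⟩ := Nat.exists_eq_add_of_le hm
  rw [poch_add] at h
  exact left_ne_zero_of_mul h

lemma sears1 (q a1 A e : ℂ) (x m : ℕ) (h1 : ∀ k : ℕ, 1 ≤ k → k ≤ x → q ^ k ≠ 1)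
    (hE : poch q (a1*A*e) x ≠ 0) (hv : poch q (A*e) x ≠ 0) (hm : m ≤ x) :
    poch q (a1*A*e) x * ∑ k ∈ Finset.Ico m (x+1), poch q a1 (k-m) / poch q q (k-m) *
       (poch q A k * e^(k-m) * poch q e (x-k) / (poch q q (x-k) * poch q (a1*A*e) k))
     = poch q A m * poch q (a1*e) (x-m) * poch q (A*e) x / (poch q q (x-m) * poch q (A*e) m) := by
  have hs := saal q a1 (A*q^m) e (x-m) (fun k hk hk' => h1 k hk (by omega))
  have hvm := poch_ne_of_le hv hm
  have e1 : poch q (A*e) x = poch q (A*e) m * poch q (A*q^m*e) (x-m) := by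
    conv_lhs => rw [show x = m + (x-m) by omega]
    rw [poch_add]; congr 2; ring
  have e2 : poch q A m * poch q (a1*e) (x-m) * poch q (A*e) x / (poch q q (x-m) * poch q (A*e) m)
    = poch q A m * (poch q (a1*e) (x-m) * poch q (A*q^m*e) (x-m) / poch q q (x-m)) := by
    rw [e1]
    generalize poch q (A*e) m = W at *
    field_simp
  rw [e2, ← hs, Finset.sum_Ico_eq_sum_range, Finset.mul_sum, Finset.mul_sum,
    show x + 1 - m = x - m + 1 by omega]
  apply Finset.sum_congr rfl
  intro l hl
  have hl' : m + l ≤ x := by simp only [Finset.mem_range] at hl; omega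
  simp only [F]
  have e3 : poch q (a1*A*e) x = poch q (a1*A*e) (m+l) * poch q (a1*(A*q^m)*e*q^l) (x-m-l) := by
    conv_lhs => rw [show x = m + l + (x-m-l) by omega]
    rw [poch_add]; congr 2; ring
  have hEm := poch_ne_of_le hE hl'
  rw [show m + l - m = l by omega, show x - (m+l) = x - m - l by omega, e3, poch_add q A]
  field_simp

lemma searsA (q a b a1 A e : ℂ) (x : ℕ) (h1 : ∀ k : ℕ, 1 ≤ k → k ≤ x → q ^ k ≠ 1)
    (hE : poch q (a1*A*e) x ≠ 0) (hv : poch q (A*e) x ≠ 0) (hd : poch q (a*b*a1) x ≠ 0) :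
    poch q (a1*A*e) x * ∑ k ∈ Finset.range (x+1),
      poch q A k * e^k * poch q e (x-k) / (poch q q (x-k) * poch q (a1*A*e) k)
        * (poch q (a*a1) k * poch q (b*a1) k / (poch q q k * poch q (a*b*a1) k))
    = ∑ m ∈ Finset.range (x+1), (poch q a m * poch q b m * a1^m / (poch q q m * poch q (a*b*a1) m))
        * e^m * (poch q A m * poch q (a1*e) (x-m) * poch q (A*e) x / (poch q q (x-m) * poch q (A*e) m)) := by
  have e1 : ∀ m ∈ Finset.range (x+1),
      (poch q a m * poch q b m * a1^m / (poch q q m * poch q (a*b*a1) m))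
        * e^m * (poch q A m * poch q (a1*e) (x-m) * poch q (A*e) x / (poch q q (x-m) * poch q (A*e) m))
      = ∑ k ∈ Finset.Ico m (x+1), poch q (a1*A*e) x * (poch q A k * e^k * poch q e (x-k) / (poch q q (x-k) * poch q (a1*A*e) k)
        * (poch q a m * poch q b m * a1^m / (poch q q m * poch q (a*b*a1) m) * (poch q a1 (k-m) / poch q q (k-m)))) := by
    intro m hm
    have hm' : m ≤ x := by simp only [Finset.mem_range] at hm; omega
    rw [← sears1 q a1 A e x m h1 hE hv hm', Finset.mul_sum, Finset.mul_sum]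
    apply Finset.sum_congr rfl
    intro k hk
    rw [Finset.mem_Ico] at hk
    have : e ^ k = e^m * e^(k-m) := by rw [← pow_add]; congr 1; omega
    rw [this]; ring
  rw [Finset.sum_congr rfl e1, Finset.sum_comm' (t' := Finset.range (x+1)) (s' := fun k => Finset.range (k+1))
    (by intro m k; simp only [Finset.mem_range, Finset.mem_Ico]; omega), Finset.mul_sum]
  apply Finset.sum_congr rfl
  intro k hk
  have hk' : k ≤ x := by simp only [Finset.mem_range] at hk; omega
  rw [← Finset.mul_sum, ← Finset.mul_sum]
  congr 2
  have hs := saal q a b a1 k (fun l hl hl' => h1 l hl (by omega))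
  have hdk := poch_ne_of_le hd hk'
  rw [← div_div, ← hs, Finset.sum_div]
  apply Finset.sum_congr rfl
  intro m hm
  have hm' : m ≤ k := by simp only [Finset.mem_range] at hm; omega
  have e3 : poch q (a*b*a1) k = poch q (a*b*a1) m * poch q (a*b*a1*q^m) (k-m) := by
    conv_lhs => rw [show k = m + (k-m) by omega]
    rw [poch_add]
  rw [e3] at hdk ⊢
  have h3 := left_ne_zero_of_mul hdk
  have h4 := right_ne_zero_of_mul hdk
  simp only [F]
  field_simp

lemma poch_L1' {q : ℂ} (hq : q ≠ 0) (B : ℂ) (x k : ℕ) (h : k ≤ x) :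
    B ^ k * poch q q x = poch q (q ^ (-(x:ℤ))) k * poch q q (x-k)
       * ∏ l ∈ Finset.range k, (-(B * q ^ (x:ℤ) * q ^ (-(l:ℤ)))) := by
  rw [poch_L1 hq x k h, mul_assoc, ← Finset.prod_mul_distrib, mul_comm]
  congr 1
  have hB : B ^ k = ∏ l ∈ Finset.range k, B := by simp
  rw [hB]
  apply Finset.prod_congr rfl
  intro l _
  rw [zpow_neg, zpow_neg, zpow_natCast, zpow_natCast]
  have := pow_ne_zero x hq
  have := pow_ne_zero l hq
  field_simp

lemma prod_tri {q s : ℂ} (hq : q ≠ 0) (hs : s ^ 2 = q) (B : ℂ) (k : ℕ) :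
    ∏ l ∈ Finset.range k, (-(B * q ^ (-(l:ℤ)))) = (-B) ^ k * s ^ (-((k:ℤ) * (k-1))) := by
  have hs0 : s ≠ 0 := by rintro rfl; simp at hs; exact hq hs.symm
  induction k with
  | zero => simp
  | succ k ih =>
    have e2 : s ^ (-(((k+1:ℕ):ℤ) * ((k+1:ℕ)-1))) = s ^ (-((k:ℤ) * (k-1))) * q ^ (-(k:ℤ)) := by
      rw [← hs, ← zpow_natCast s 2, ← zpow_mul, ← zpow_add₀ hs0]; congr 1; push_cast; ring
    rw [Finset.prod_range_succ, ih, e2]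
    ring

end qR
namespace qR

/-- coefficient -/
def beta (q c1 c2 c3 : ℂ) (M n m : ℕ) : ℂ :=
  poch q (q ^ (-((M:ℤ)-n))) m * poch q (q ^ (-((M:ℤ)+n+1)) / (c2*c3)) m
   * (∏ l ∈ Finset.range m, (-(c3 * q ^ ((M:ℤ)+1) * q ^ (-(l:ℤ)))))
   / (poch q q m * poch q (q ^ (-(M:ℤ))) m * poch q (q * c1) m * poch q (c3 * q ^ ((M:ℤ)+1-m)) m)

lemma searsB {q s c1 c2 c3 : ℂ} (hq : q ≠ 0) (hs : s ^ 2 = q) (hc2 : c2 ≠ 0) (hc3 : c3 ≠ 0)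
    (M n x : ℕ) (hx : x ≤ M) (hn : n ≤ M)
    (h1 : ∀ k : ℕ, 1 ≤ k → k ≤ M → q ^ k ≠ 1)
    (hE : poch q (c1*c2*c3*q^((M:ℤ)+2)) x ≠ 0)
    (h2 : poch q (q*c1) x ≠ 0) (h3 : poch q (q*c2) x ≠ 0)
    (h4 : ∀ m, m ≤ x → poch q (c3*q^((M:ℤ)+1-m)) m ≠ 0) :
    ∑ k ∈ Finset.range (n + 1),
        poch q (q ^ (-(n:ℤ))) k * poch q (c2 * c3 * q ^ ((n:ℤ) + 1)) k * poch q (q ^ (-(x:ℤ))) k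
            * poch q (c1 * c2 * q ^ ((x:ℤ) + 1)) k * q ^ k
          / (poch q (q * c2) k * poch q (c1 * c2 * c3 * q ^ ((M:ℤ) + 2)) k
              * poch q (q ^ (-(M:ℤ))) k * poch q q k)
    = poch q (c3 * q ^ ((M:ℤ)+1-x)) x * poch q (q*c1) x * (-c2)^x * s ^ ((x:ℤ)*(x+1))
        / (poch q (c1*c2*c3*q^((M:ℤ)+2)) x * poch q (q*c2) x) *
      ∑ m ∈ Finset.range (M - n + 1), beta q c1 c2 c3 M n m *
        (poch q (q ^ (-(x:ℤ))) m * poch q (c1 * c2 * q ^ ((x:ℤ) + 1)) m) := by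
  have hs0 : s ≠ 0 := by rintro rfl; simp at hs; exact hq hs.symm
  have hqx : poch q q x ≠ 0 := poch_qq h1 hx
  have hd : poch q (q ^ (-(M:ℤ))) x ≠ 0 := poch_negN hq h1 hx le_rfl
  have hz : ∀ z : ℤ, q ^ z ≠ 0 := fun z => zpow_ne_zero z hq
  rw [sum_ext (a := n) (b := x) (by intro k hk; rw [poch_neg_zero hq hk]; simp)
    (by intro k hk; rw [poch_neg_zero hq hk]; simp)]
  rw [sum_ext (a := M - n) (b := x)
    (by
      intro k hk
      have := poch_neg_zero hq hk
      rw [Nat.cast_sub hn] at this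
      rw [beta, this]; simp)
    (by intro k hk; rw [poch_neg_zero hq hk]; simp)]
  -- the parameters
  set a := q ^ (-((M:ℤ)-n)) with ha
  set b := q ^ (-((M:ℤ)+n+1)) / (c2*c3) with hb
  set a1 := c2*c3*q^((M:ℤ)+1) with ha1
  set A := c1 * c2 * q ^ ((x:ℤ) + 1) with hA
  set e := q ^ (-(x:ℤ)) / c2 with he
  have zz : ∀ (k : ℤ), q ^ (k + 1) = q ^ k * q := fun k => by rw [zpow_add₀ hq, zpow_one]
  have z2 : ∀ (k : ℤ), q ^ (k + 2) = q ^ k * q ^ 2 := fun k => by rw [zpow_add₀ hq]; norm_cast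
  have r1 : a1 * A * e = c1*c2*c3*q^((M:ℤ)+2) := by
    rw [ha1, hA, he]
    simp only [z2, neg_sub, neg_add, zpow_add₀ hq, zpow_sub₀ hq, zpow_neg, zpow_one, zpow_natCast]
    have t1 := pow_ne_zero M hq
    have t2 := pow_ne_zero n hq
    have t3 := pow_ne_zero x hq
    generalize q ^ M = U1 at *
    generalize q ^ n = U2 at *
    generalize q ^ x = U3 at *
    field_simp
  have r2 : A * e = q * c1 := by
    rw [hA, he]
    simp only [z2, neg_sub, neg_add, zpow_add₀ hq, zpow_sub₀ hq, zpow_neg, zpow_one, zpow_natCast]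
    have t1 := pow_ne_zero M hq
    have t2 := pow_ne_zero n hq
    have t3 := pow_ne_zero x hq
    generalize q ^ M = U1 at *
    generalize q ^ n = U2 at *
    generalize q ^ x = U3 at *
    field_simp
  have r3 : a * b * a1 = q ^ (-(M:ℤ)) := by
    rw [ha, hb, ha1]
    simp only [z2, neg_sub, neg_add, zpow_add₀ hq, zpow_sub₀ hq, zpow_neg, zpow_one, zpow_natCast]
    have t1 := pow_ne_zero M hq
    have t2 := pow_ne_zero n hq
    have t3 := pow_ne_zero x hq
    generalize q ^ M = U1 at *
    generalize q ^ n = U2 at *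
    generalize q ^ x = U3 at *
    field_simp
  have r4 : a * a1 = c2 * c3 * q ^ ((n:ℤ)+1) := by
    rw [ha, ha1]
    simp only [z2, neg_sub, neg_add, zpow_add₀ hq, zpow_sub₀ hq, zpow_neg, zpow_one, zpow_natCast]
    have t1 := pow_ne_zero M hq
    have t2 := pow_ne_zero n hq
    have t3 := pow_ne_zero x hq
    generalize q ^ M = U1 at *
    generalize q ^ n = U2 at *
    generalize q ^ x = U3 at *
    field_simp
  have r5 : b * a1 = q ^ (-(n:ℤ)) := by
    rw [hb, ha1]
    simp only [z2, neg_sub, neg_add, zpow_add₀ hq, zpow_sub₀ hq, zpow_neg, zpow_one, zpow_natCast]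
    have t1 := pow_ne_zero M hq
    have t2 := pow_ne_zero n hq
    have t3 := pow_ne_zero x hq
    generalize q ^ M = U1 at *
    generalize q ^ n = U2 at *
    generalize q ^ x = U3 at *
    field_simp
  have r6 : a1 * e = c3 * q ^ ((M:ℤ)+1-x) := by
    rw [ha1, he]
    simp only [z2, neg_sub, neg_add, zpow_add₀ hq, zpow_sub₀ hq, zpow_neg, zpow_one, zpow_natCast]
    have t1 := pow_ne_zero M hq
    have t2 := pow_ne_zero n hq
    have t3 := pow_ne_zero x hq
    generalize q ^ M = U1 at *
    generalize q ^ n = U2 at *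
    generalize q ^ x = U3 at *
    field_simp
  have key := searsA q a b a1 A e x (fun k hk hk' => h1 k hk (by omega))
    (by rw [r1]; exact hE) (by rw [r2]; exact h2) (by rw [r3]; exact hd)
  rw [r1, r2, r3, r4, r5, r6] at key
  -- both sides
  have L : ∀ k ∈ Finset.range (x+1),
     poch q (q ^ (-(n:ℤ))) k * poch q (c2 * c3 * q ^ ((n:ℤ) + 1)) k * poch q (q ^ (-(x:ℤ))) k
            * poch q A k * q ^ k
          / (poch q (q * c2) k * poch q (c1 * c2 * c3 * q ^ ((M:ℤ) + 2)) k
              * poch q (q ^ (-(M:ℤ))) k * poch q q k)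
     = poch q q x * (-c2)^x * s ^ ((x:ℤ)*(x+1)) / poch q (q*c2) x * (
      poch q A k * e^k * poch q e (x-k) / (poch q q (x-k) * poch q (c1*c2*c3*q^((M:ℤ)+2)) k)
        * (poch q (c2 * c3 * q ^ ((n:ℤ)+1)) k * poch q (q ^ (-(n:ℤ))) k / (poch q q k * poch q (q ^ (-(M:ℤ))) k))) := by
    intro k hk
    have hk' : k ≤ x := by simp only [Finset.mem_range] at hk; omega
    have l1 := poch_L1' hq e x k hk'
    have hB : e * q ^ (x:ℤ) = 1/c2 := by
      rw [he, zpow_neg]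
      have := hz x
      field_simp
    rw [hB, prod_tri hq hs] at l1
    have l2 := poch_L2 hq hs hc2 x
    have l3 := poch_L2 hq hs hc2 k
    have l4 : poch q e x = poch q e (x-k) * poch q (q ^ (-(k:ℤ)) / c2) k := by
      conv_lhs => rw [show x = (x-k) + k by omega]
      rw [poch_add]; congr 2
      rw [he, show -(k:ℤ) = -(x:ℤ) + ((x-k:ℕ):ℤ) by push_cast [hk']; ring, zpow_add₀ hq, zpow_natCast]
      ring
    rw [← he, l4, l3] at l2
    have hqxk : poch q q (x-k) ≠ 0 := poch_qq h1 (by omega)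
    have hqk : poch q q k ≠ 0 := poch_qq h1 (by omega)
    have hEk := poch_ne_of_le hE hk'
    have h3k := poch_ne_of_le h3 hk'
    have hdk := poch_ne_of_le hd hk'
    have sx : s ^ (-((x:ℤ)*(x+1))) = (s ^ ((x:ℤ)*(x+1)))⁻¹ := zpow_neg _ _
    have sk : s ^ (-((k:ℤ)*(k-1))) = s ^ (-((k:ℤ)*(k+1))) * q^k := by
      rw [← hs, ← pow_mul, ← zpow_natCast s, ← zpow_add₀ hs0]; congr 1; push_cast; ring
    have cx : (-1/c2)^x = ((-c2)^x)⁻¹ := by rw [← inv_pow]; congr 1; field_simp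
    have hc2x : (-c2)^x ≠ 0 := pow_ne_zero _ (neg_ne_zero.2 hc2)
    have hsx : s ^ ((x:ℤ)*(x+1)) ≠ 0 := zpow_ne_zero _ hs0
    have hsk : s ^ (-((k:ℤ)*(k+1))) ≠ 0 := zpow_ne_zero _ hs0
    have hck : (-1/c2)^k ≠ 0 := pow_ne_zero _ (div_ne_zero (by norm_num) hc2)
    have hck' : (-(1/c2))^k = (-1/c2)^k := by congr 1; ring
    rw [sx, cx] at l2
    rw [sk, hck'] at l1
    have hw : poch q (q ^ (-(x:ℤ))) k * q ^ k * poch q (q*c2) x * poch q q (x-k) =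
       poch q q x * (-c2)^x * s ^ ((x:ℤ)*(x+1)) * e^k * poch q e (x-k) * poch q (q*c2) k := by
      generalize poch q (q*c2) k = X1 at *
      generalize poch q (q*c2) x = X2 at *
      generalize poch q e (x-k) = X3 at *
      generalize (-1/c2)^k = X4 at *
      generalize (-c2)^x = X5 at *
      generalize s ^ ((x:ℤ)*(x+1)) = X6 at *
      generalize s ^ (-((k:ℤ)*(k+1))) = X7 at *
      generalize poch q (q ^ (-(x:ℤ))) k = X8 at *
      have l2' : X3 * (X4 * X7 * X1) * (X5 * X6) = X2 := by
        rw [l2]; field_simp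
      rw [← l2']
      linear_combination (- X3 * X1 * X5 * X6) * l1
    clear_value e A
    generalize poch q (q ^ (-(n:ℤ))) k = Y1 at *
    generalize poch q (c2 * c3 * q ^ ((n:ℤ) + 1)) k = Y2 at *
    generalize poch q A k = Y3 at *
    generalize poch q (q ^ (-(x:ℤ))) k = Y4 at *
    generalize poch q (c1 * c2 * c3 * q ^ ((M:ℤ) + 2)) k = Y5 at *
    generalize poch q (q ^ (-(M:ℤ))) k = Y6 at *
    generalize poch q (q*c2) k = X1 at *
    generalize poch q (q*c2) x = X2 at *
    generalize poch q e (x-k) = X3 at *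
    generalize (-c2)^x = X5 at *
    generalize s ^ ((x:ℤ)*(x+1)) = X6 at *
    generalize poch q q (x-k) = X7 at *
    generalize poch q q x = X8 at *
    generalize poch q q k = X9 at *
    rw [eq_comm, ← sub_eq_zero]
    field_simp
    linear_combination (-Y1*Y2*Y3) * hw
  have R : ∀ m ∈ Finset.range (x+1),
    (poch q a m * poch q b m * a1^m / (poch q q m * poch q (q ^ (-(M:ℤ))) m))
        * e^m * (poch q A m * poch q (c3 * q ^ ((M:ℤ)+1-x)) (x-m) * poch q (q*c1) x / (poch q q (x-m) * poch q (q*c1) m))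
    = poch q (c3 * q ^ ((M:ℤ)+1-x)) x * poch q (q*c1) x / poch q q x *
      (beta q c1 c2 c3 M n m *
        (poch q (q ^ (-(x:ℤ))) m * poch q A m)) := by
    intro m hm
    have hm' : m ≤ x := by simp only [Finset.mem_range] at hm; omega
    have l1 := poch_L1' hq (a1*e) x m hm'
    have hB : a1 * e * q ^ (x:ℤ) = c3 * q ^ ((M:ℤ)+1) := by
      rw [r6, mul_assoc, ← zpow_add₀ hq]; congr 2; ring
    rw [hB, mul_pow] at l1
    have l4 : poch q (c3 * q ^ ((M:ℤ)+1-x)) x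
       = poch q (c3 * q ^ ((M:ℤ)+1-x)) (x-m) * poch q (c3 * q ^ ((M:ℤ)+1-m)) m := by
      conv_lhs => rw [show x = (x-m) + m by omega]
      rw [poch_add, show x - m + m = x by omega]; congr 2
      rw [show (M:ℤ)+1-m = (M:ℤ)+1-x + ((x-m:ℕ):ℤ) by push_cast [hm']; ring, zpow_add₀ hq ((M:ℤ)+1-x), zpow_natCast]
      ring
    have hqxk : poch q q (x-m) ≠ 0 := poch_qq h1 (by omega)
    have hqk : poch q q m ≠ 0 := poch_qq h1 (by omega)
    have h2k := poch_ne_of_le h2 hm'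
    have hdk := poch_ne_of_le hd hm'
    have h4m := h4 m hm'
    rw [l4, beta, ← ha, ← hb]
    clear_value e A a1 a b
    generalize poch q a m = Y1 at *
    generalize poch q b m = Y2 at *
    generalize poch q A m = Y3 at *
    generalize poch q (q ^ (-(x:ℤ))) m = Y4 at *
    generalize poch q (c3 * q ^ ((M:ℤ)+1-m)) m = Y5 at *
    generalize poch q (q ^ (-(M:ℤ))) m = Y6 at *
    generalize poch q (q*c1) m = X1 at *
    generalize poch q (q*c1) x = X2 at *
    generalize poch q (c3 * q ^ ((M:ℤ)+1-x)) (x-m) = X3 at *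
    generalize poch q q (x-m) = X7 at *
    generalize poch q q x = X8 at *
    generalize poch q q m = X9 at *
    generalize ∏ l ∈ Finset.range m, (-(c3 * q ^ ((M:ℤ)+1) * q ^ (-(l:ℤ)))) = X10 at *
    rw [eq_comm, ← sub_eq_zero]
    clear key L
    clear l4 h4 hE h3 h1 hd hz r1 r2 r3 r4 r5 r6
    field_simp
    linear_combination (-X3*X2*Y1*Y2*Y3) * l1
  rw [Finset.sum_congr rfl L, ← Finset.mul_sum]
  rw [Finset.sum_congr rfl R, ← Finset.mul_sum] at key
  generalize (∑ k ∈ Finset.range (x+1), _ : ℂ) = S1 at *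
  generalize (∑ k ∈ Finset.range (x+1), _ : ℂ) = S2 at *
  generalize poch q (c1 * c2 * c3 * q ^ ((M:ℤ) + 2)) x = Y5 at *
  rw [show S1 = Y5 * S1 / Y5 by field_simp, key]
  field_simp

end qR
namespace qR
open MvPolynomial

lemma deg_lemma (d : ℕ) (β : ℕ → ℂ) (A B : ℕ → MvPolynomial (Fin 2) ℂ)
    (hA : ∀ l, (A l).totalDegree ≤ 1) (hB : ∀ l, (B l).totalDegree ≤ 1)
    (f : Fin 2 → Polynomial ℂ) (hf : ∀ i, (f i).natDegree ≤ 1)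
    (hAf : ∀ l, (aeval f (A l)).natDegree = 0) (hBf : ∀ l, (aeval f (B l)).natDegree = 1)
    (hβ : β d ≠ 0) :
    (∑ k ∈ Finset.range (d+1), C (β k) * (∏ l ∈ Finset.Ico k d, A l) * ∏ l ∈ Finset.range k, B l).totalDegree
      = d := by
  apply le_antisymm
  · apply totalDegree_finsetSum_le
    intro k hk
    have hk' : k ≤ d := by simp only [Finset.mem_range] at hk; omega
    refine (totalDegree_mul _ _).trans ?_
    have h1 : (C (β k) * (∏ l ∈ Finset.Ico k d, A l)).totalDegree ≤ d - k := by
      refine (totalDegree_mul _ _).trans ?_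
      rw [totalDegree_C, zero_add]
      refine (totalDegree_finset_prod _ _).trans ?_
      refine (Finset.sum_le_sum (fun l _ => hA l)).trans ?_
      simp
    have h2 : (∏ l ∈ Finset.range k, B l).totalDegree ≤ k := by
      refine (totalDegree_finset_prod _ _).trans ?_
      refine (Finset.sum_le_sum (fun l _ => hB l)).trans ?_
      simp
    omega
  · set P := ∑ k ∈ Finset.range (d+1), C (β k) * (∏ l ∈ Finset.Ico k d, A l) * ∏ l ∈ Finset.range k, B l with hP
    have h1 : (aeval f P).natDegree ≤ P.totalDegree := by
      have := aeval_natDegree_le P (m := P.totalDegree) le_rfl f (n := 1) hf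
      simpa using this
    refine le_trans ?_ h1
    have hB0 : ∀ l, aeval f (B l) ≠ 0 := by
      intro l h; have := hBf l; rw [h] at this; simp at this
    have hprod : ∀ k, (∏ l ∈ Finset.range k, aeval f (B l)).natDegree = k := by
      intro k
      rw [Polynomial.natDegree_prod _ _ (fun l _ => hB0 l), Finset.sum_congr rfl (fun l _ => hBf l)]
      simp
    have e : aeval f P = ∑ k ∈ Finset.range (d+1), Polynomial.C (β k) * (∏ l ∈ Finset.Ico k d, aeval f (A l)) * ∏ l ∈ Finset.range k, aeval f (B l) := by
      rw [hP, map_sum]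
      apply Finset.sum_congr rfl
      intro k _
      rw [map_mul, map_mul, map_prod, map_prod, aeval_C]
      rfl
    have hlast : (Polynomial.C (β d) * (∏ l ∈ Finset.Ico d d, aeval f (A l)) * ∏ l ∈ Finset.range d, aeval f (B l)).natDegree = d := by
      rw [Finset.Ico_self, Finset.prod_empty, mul_one, Polynomial.natDegree_C_mul hβ, hprod]
    rw [e, Finset.sum_range_succ]
    rcases Nat.eq_zero_or_pos d with h0 | h0
    · omega
    rw [Polynomial.natDegree_add_eq_right_of_natDegree_lt]
    · rw [hlast]
    · rw [hlast]
      refine lt_of_le_of_lt (Polynomial.natDegree_sum_le_of_forall_le (n := d - 1) _ _ ?_) (by omega)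
      intro k hk
      simp only [Finset.mem_range] at hk
      refine Polynomial.natDegree_mul_le.trans ?_
      rw [hprod]
      have : (Polynomial.C (β k) * ∏ l ∈ Finset.Ico k d, (aeval f) (A l)).natDegree = 0 := by
        refine Nat.le_zero.1 (Polynomial.natDegree_mul_le.trans ?_)
        rw [Polynomial.natDegree_C, zero_add]
        refine (Polynomial.natDegree_prod_le _ _).trans ?_
        rw [Finset.sum_congr rfl (fun l _ => hAf l)]; simp
      omega

/-- affine polynomial -/
def aff (v : Fin 2) (a b : ℂ) : MvPolynomial (Fin 2) ℂ := C a + C b * X v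

lemma aff_deg (v : Fin 2) (a b : ℂ) : (aff v a b).totalDegree ≤ 1 := by
  refine (totalDegree_add _ _).trans ?_
  rw [totalDegree_C]
  simp only [zero_le, sup_of_le_right]
  refine (totalDegree_mul _ _).trans ?_
  rw [totalDegree_C, totalDegree_X]

lemma aff_aeval (v : Fin 2) (a b : ℂ) (f : Fin 2 → Polynomial ℂ) :
    aeval f (aff v a b) = Polynomial.C a + Polynomial.C b * f v := by
  simp [aff, ← Polynomial.algebraMap_eq]

lemma aff_natDeg (a b : ℂ) (hb : b ≠ 0) : 
    (Polynomial.C a + Polynomial.C b * Polynomial.X).natDegree = 1 := by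
  rw [add_comm]; exact Polynomial.natDegree_linear hb

/-- factors of `φ` -/
def fa (q c : ℂ) (l : ℕ) : ℂ := 1 + c * q * q^l * q^l - q^l * (1 + c*q)

lemma phi_eq {q : ℂ} (hq : q ≠ 0) (c : ℂ) (y k : ℕ) :
    poch q (q ^ (-(y:ℤ))) k * poch q (c * q ^ ((y:ℤ)+1)) k
      = ∏ l ∈ Finset.range k, (fa q c l + (-q^l) * lam q c y) := by
  rw [poch, poch, ← Finset.prod_mul_distrib]
  apply Finset.prod_congr rfl
  intro l _
  rw [fa, lam, zpow_neg, zpow_add₀ hq, zpow_natCast, zpow_one]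
  have := pow_ne_zero y hq
  field_simp
  ring

def xa (q c : ℂ) (N l : ℕ) : ℂ := 1 + q^l*q^l * (q^N*q^N*q*c)⁻¹ - q^l*(q^N*q*c)⁻¹*(1+c*q)

lemma xfac_eq {q c D : ℂ} (hq : q ≠ 0) (hc : c ≠ 0) (N x l : ℕ) (hx : x ≤ N)
    (hD : D = q ^ (-((N:ℤ)+1+x)) / c) :
    (1 - q ^ (-((N-x:ℕ):ℤ)) * q^l) * (1 - D * q^l) = xa q c N l + (-(q^l*(q^N*q*c)⁻¹)) * lam q c x := by
  have e : q ^ (-((N-x:ℕ):ℤ)) = q^x * (q^N)⁻¹ := by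
    rw [Nat.cast_sub hx, neg_sub, zpow_sub₀ hq, zpow_natCast, zpow_natCast]; rfl
  rw [e, hD, xa, lam, zpow_neg, zpow_neg, zpow_add₀ hq, zpow_add₀ hq, zpow_add₀ hq, zpow_natCast, zpow_natCast, zpow_one]
  have := pow_ne_zero x hq
  have := pow_ne_zero N hq
  field_simp
  ring

def alpha (q c0 c4 : ℂ) (j k : ℕ) : ℂ :=
  poch q (q ^ (-(j:ℤ))) k * poch q (c0 * c4 * q ^ ((j:ℤ) + 1)) k * q ^ k / (poch q (q * c0) k * poch q q k)

lemma p2sum {q c0 c4 D : ℂ} (hq : q ≠ 0) (L j : ℕ) (Y1 Y2 : ℕ → ℂ) (hj : j ≤ L)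
    (h1 : ∀ k : ℕ, 1 ≤ k → k ≤ L → q ^ k ≠ 1) (hD : poch q D j ≠ 0) :
    binom q (L:ℤ) (j:ℤ) * poch q D j * ∑ k ∈ Finset.range (j+1),
      poch q (q ^ (-(j:ℤ))) k * poch q (c0 * c4 * q ^ ((j:ℤ) + 1)) k * Y1 k
            * Y2 k * q ^ k
          / (poch q (q * c0) k * poch q D k
              * poch q (q ^ (-(L:ℤ))) k * poch q q k)
    = q ^ (L * j) / (poch q q j * ∏ l ∈ Finset.range j, (-q^l)) *
      ∑ k ∈ Finset.range (j+1), alpha q c0 c4 j k *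
        (∏ l ∈ Finset.Ico k j, ((1 - q ^ (-(L:ℤ)) * q^l) * (1 - D * q^l))) * (Y1 k * Y2 k) := by
  have hb : binom q (L:ℤ) (j:ℤ) = q ^ (L * j) / (poch q q j * ∏ l ∈ Finset.range j, (-q^l)) * poch q (q ^ (-(L:ℤ))) j := by
    have l1 := poch_L1 hq L j hj
    have e : ∏ l ∈ Finset.range j, (-(q ^ (-(L:ℤ)) * q ^ l)) = (q ^ (L*j))⁻¹ * ∏ l ∈ Finset.range j, (-q^l) := by
      have : (q ^ (L*j))⁻¹ = ∏ l ∈ Finset.range j, q ^ (-(L:ℤ)) := by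
        rw [Finset.prod_const, Finset.card_range, zpow_neg, zpow_natCast, pow_mul, inv_pow]
      rw [this, ← Finset.prod_mul_distrib]
      apply Finset.prod_congr rfl
      intro l _; ring
    rw [e] at l1
    have hP : ∏ l ∈ Finset.range j, (-q^l) ≠ 0 :=
      Finset.prod_ne_zero_iff.2 (fun l _ => neg_ne_zero.2 (pow_ne_zero l hq))
    rw [binom, if_pos (by omega), show ((L:ℤ)-j).toNat = L - j by omega, Int.toNat_natCast, Int.toNat_natCast]
    have h2 : poch q q j ≠ 0 := poch_qq h1 (by omega)
    have h3 : poch q q (L-j) ≠ 0 := poch_qq h1 (by omega)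
    have h4 := pow_ne_zero (L*j) hq
    generalize ∏ l ∈ Finset.range j, (-q^l) = W at *
    generalize q^(L*j) = V at *
    generalize poch q (q ^ (-(L:ℤ))) j = V2 at *
    field_simp
    field_simp at l1
    linear_combination (-1)*l1
  rw [hb, mul_assoc, mul_assoc]
  congr 1
  rw [← mul_assoc, Finset.mul_sum]
  apply Finset.sum_congr rfl
  intro k hk
  have hk' : k ≤ j := by simp only [Finset.mem_range] at hk; omega
  have hDk := poch_ne_of_le hD hk'
  have hLk : poch q (q ^ (-(L:ℤ))) k ≠ 0 := poch_negN hq h1 (by omega) le_rfl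
  have e1 : ∀ a : ℂ, poch q a j = poch q a k * ∏ l ∈ Finset.Ico k j, (1 - a * q^l) := by
    intro a
    rw [poch, poch, Finset.prod_range_mul_prod_Ico _ hk']
  rw [e1, e1 D, alpha, Finset.prod_mul_distrib]
  have : poch q q k ≠ 0 := poch_qq h1 (by omega)
  generalize ∏ l ∈ Finset.Ico k j, (1 - D * q^l) = Z1 at *
  generalize ∏ l ∈ Finset.Ico k j, (1 - q ^ (-(L:ℤ)) * q^l) = Z2 at *
  generalize poch q (q ^ (-(L:ℤ))) k = Z3 at *
  generalize poch q D k = Z4 at *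
  generalize poch q (q * c0) k = Z5 at *
  field_simp

end qR
namespace qR

lemma xid {q s c0 c1 c2 c3 c4 t0 t1 t2 t3 t4 : ℂ} (hq : q ≠ 0) (hs : s^2 = q) (hs0 : s ≠ 0)
    (hc2 : c2 ≠ 0) (ht1 : t1 ≠ 0) (ht2 : t2 ≠ 0) (ht3 : t3 ≠ 0) (ht4 : t4 ≠ 0)
    (e1 : t1^2 = c1) (e2 : t2^2 = c2) (e3 : t3^2 = c3) (e4 : t4^2 = c4) (N M j x : ℕ)
    (hM : M + j = N) (hx : x ≤ M)
    (hc0 : c0 = (q ^ (2 * (N : ℤ) + 3) * c1 * c2 * c3 * c4)⁻¹)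
    (ht0 : t0 = (s ^ (2 * (N : ℤ) + 3) * t1 * t2 * t3 * t4)⁻¹)
    (hw : poch q (c0*c4*q^((j:ℤ)+1)) (N+1) ≠ 0)
    (hE : poch q (c1*c2*c3*q^((M:ℤ)+2)) x ≠ 0) (h2 : poch q (q*c2) x ≠ 0) :
    poch q (c3*q^((M:ℤ)+1-x)) x * poch q (q*c1) x * (-c2)^x * s^((x:ℤ)*(x+1)) /
        (poch q (c1*c2*c3*q^((M:ℤ)+2)) x * poch q (q*c2) x)
      * (poch q (q*c3) (M-x) / ((s*t0)^(2*(j:ℤ)-((N-x:ℕ):ℤ)) * poch q (c0*c4*q^((j:ℤ)+1)) (N-x+1)))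
      * q^((N-x)*j)
    = poch q (q*c3) M * q^(N*j) / ((s*t0)^(2*(j:ℤ)-N) * poch q (c0*c4*q^((j:ℤ)+1)) (N+1))
      * ((t4/t3)^x * (poch q (q*c1) x / poch q (q*c2) x * (t2/t1)^x)) := by
  have hc1 : c1 ≠ 0 := by rw [← e1]; exact pow_ne_zero _ ht1
  have hc3 : c3 ≠ 0 := by rw [← e3]; exact pow_ne_zero _ ht3
  have hc4 : c4 ≠ 0 := by rw [← e4]; exact pow_ne_zero _ ht4
  have hqN := pow_ne_zero N hq
  have hsN := pow_ne_zero N hs0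
  have hqj := pow_ne_zero j hq
  have hqM := pow_ne_zero M hq
  have hst : s*t0 = (q^N*q*t1*t2*t3*t4)⁻¹ := by
    rw [ht0, ← hs, zpow_add₀ hs0, show (2*(N:ℤ)) = ((2*N:ℕ):ℤ) by push_cast; ring, zpow_natCast,
      show s^(3:ℤ) = s^3 from zpow_natCast s 3, pow_mul]
    have := pow_ne_zero N (pow_ne_zero 2 hs0)
    field_simp
  have hst0 : s*t0 ≠ 0 := by
    rw [hst]; positivity
  have eA : poch q (q*c3) M = poch q (q*c3) (M-x) * poch q (c3*q^((M:ℤ)+1-x)) x := by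
    rw [show poch q (q*c3) M = poch q (q*c3) ((M-x)+x) by congr 1; omega, poch_add]
    congr 2
    rw [show (M:ℤ)+1-x = ((M-x:ℕ):ℤ)+1 by omega, zpow_add₀ hq, zpow_natCast, zpow_one]; ring
  have eB : poch q (c0*c4*q^((j:ℤ)+1)) (N+1) = poch q (c0*c4*q^((j:ℤ)+1)) (N-x+1) *
      poch q (q^(-(x:ℤ))/(c1*c2*c3*q^((M:ℤ)+1))) x := by
    rw [show poch q (c0*c4*q^((j:ℤ)+1)) (N+1) = poch q (c0*c4*q^((j:ℤ)+1)) ((N-x+1)+x) by congr 1; omega, poch_add]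
    congr 2
    have hxN : q^(N-x+1) = q^N*q*(q^x)⁻¹ := by
      have : q^(N-x) * q^x = q^N := by rw [← pow_add]; congr 1; omega
      rw [pow_succ, ← this]
      have := pow_ne_zero x hq
      field_simp
    have hNj : q^N = q^M*q^j := by rw [← pow_add, hM]
    rw [hxN, hc0, zpow_neg, zpow_add₀ hq, zpow_add₀ hq, zpow_add₀ hq, zpow_natCast, zpow_natCast, zpow_natCast, zpow_one,
      show (2*(N:ℤ)) = ((2*N:ℕ):ℤ) by push_cast; ring, zpow_natCast,
      show q^(3:ℤ) = q^3 from zpow_natCast q 3, mul_comm 2 N, pow_mul, hNj]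
    have := pow_ne_zero x hq
    field_simp
  have hcc : c1*c2*c3*q^((M:ℤ)+1) ≠ 0 := by
    have := zpow_ne_zero ((M:ℤ)+1) hq
    positivity
  have eD := poch_L2 hq hs hcc x
  rw [show q*(c1*c2*c3*q^((M:ℤ)+1)) = c1*c2*c3*q^((M:ℤ)+2) by
    rw [show (M:ℤ)+2 = (M+1)+1 by ring, zpow_add₀ hq (_+1) 1, zpow_one]; ring] at eD
  have eP1 : q^(N*j) = q^((N-x)*j) * (q^j)^x := by
    rw [← pow_mul, ← pow_add, mul_comm j x, ← add_mul]; congr 2; omega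
  have eP2 : (s*t0)^(2*(j:ℤ)-((N-x:ℕ):ℤ)) = (s*t0)^(2*(j:ℤ)-N) * (s*t0)^x := by
    rw [← zpow_natCast (s*t0) x, ← zpow_add₀ hst0]; congr 1; omega
  have base : c2 * (1/(c1*c2*c3*q^((M:ℤ)+1))) = (s*t0) * q^j * (t4/t3) * (t2/t1) := by
    have hNj : q^N = q^M*q^j := by rw [← pow_add, hM]
    rw [hst, zpow_add₀ hq, zpow_natCast, zpow_one, hNj, ← e1, ← e2, ← e3]
    field_simp
  have basex : (-c2)^x * (-1/(c1*c2*c3*q^((M:ℤ)+1)))^x = (s*t0)^x * (q^j)^x * (t4/t3)^x * (t2/t1)^x := by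
    rw [← mul_pow, ← mul_pow, ← mul_pow, ← mul_pow, ← base]; congr 1; ring
  have hw1 : poch q (c0*c4*q^((j:ℤ)+1)) (N-x+1) ≠ 0 := fun h => hw (by rw [eB, h, zero_mul])
  have hsx : s^(-((x:ℤ)*(x+1))) = (s^((x:ℤ)*(x+1)))⁻¹ := zpow_neg _ _
  rw [eD, hsx] at eB
  have hsx0 : s^((x:ℤ)*(x+1)) ≠ 0 := zpow_ne_zero _ hs0
  have hz1 : (-1/(c1*c2*c3*q^((M:ℤ)+1)))^x ≠ 0 := pow_ne_zero _ (div_ne_zero (by norm_num) hcc)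
  have hz2 : (s*t0)^(2*(j:ℤ)-N) ≠ 0 := zpow_ne_zero _ hst0
  have hz3 : (s*t0)^x ≠ 0 := pow_ne_zero _ hst0
  rw [eA, eB, eP1, eP2]
  generalize (-1/(c1*c2*c3*q^((M:ℤ)+1)))^x = a1 at *
  generalize (s*t0)^(2*(j:ℤ)-N) = a2 at *
  generalize (s*t0)^x = a3 at *
  generalize s^((x:ℤ)*(x+1)) = a4 at *
  generalize poch q (c0*c4*q^((j:ℤ)+1)) (N-x+1) = a5 at *
  generalize poch q (c1*c2*c3*q^((M:ℤ)+2)) x = a6 at *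
  generalize poch q (q*c2) x = a7 at *
  generalize poch q (q*c1) x = a8 at *
  generalize (q^j)^x = a9 at *
  generalize (t4/t3)^x = a10 at *
  generalize (t2/t1)^x = a11 at *
  generalize (-c2)^x = a12 at *
  generalize poch q (q*c3) (M-x) = a13 at *
  generalize poch q (c3*q^((M:ℤ)+1-x)) x = a14 at *
  generalize q^((N-x)*j) = a15 at *
  clear eD eA eB eP1 eP2 base
  field_simp
  linear_combination a8*a13*a14*a15*basex

end qR
namespace qR
open MvPolynomial

lemma beta_ne {q c1 c2 c3 : ℂ} {N : ℕ} (hq : q ≠ 0) (hc2 : c2 ≠ 0) (hc3 : c3 ≠ 0)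
    (g1 : Gn q c1 (2*N+5)) (g23 : Gn q (c2*c3) (2*N+5)) (g3 : Gn q c3 (2*N+5))
    (hq1 : ∀ k : ℕ, 1 ≤ k → k ≤ N → q ^ k ≠ 1) (M n : ℕ) (hn : n ≤ M) (hM : M ≤ N) :
    beta q c1 c2 c3 M n (M-n) ≠ 0 := by
  have hh : ∀ k : ℕ, 1 ≤ k → k ≤ M → q ^ k ≠ 1 := fun k h h' => hq1 k h (h'.trans hM)
  have a1 : poch q (q^(-((M:ℤ)-n))) (M-n) ≠ 0 := by
    rw [show (M:ℤ)-n = ((M-n:ℕ):ℤ) by omega]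
    exact poch_negN hq hh le_rfl (by omega)
  have a2 : poch q (q^(-((M:ℤ)+n+1))/(c2*c3)) (M-n) ≠ 0 :=
    Gn.poch_inv hq (mul_ne_zero hc2 hc3) g23 ((M:ℤ)+n+1) (M-n) rfl (by omega) (by omega)
  have a3 : (∏ l ∈ Finset.range (M-n), -(c3*q^((M:ℤ)+1)*q^(-(l:ℤ)))) ≠ 0 :=
    Finset.prod_ne_zero_iff.2 (fun l _ => neg_ne_zero.2
      (mul_ne_zero (mul_ne_zero hc3 (zpow_ne_zero _ hq)) (zpow_ne_zero _ hq)))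
  have a4 : poch q q (M-n) ≠ 0 := poch_qq hh (by omega)
  have a5 : poch q (q^(-(M:ℤ))) (M-n) ≠ 0 := poch_negN hq hh (by omega) le_rfl
  have a6 : poch q (q*c1) (M-n) ≠ 0 := Gn.poch hq g1 1 (M-n) (by rw [zpow_one]; ring) le_rfl (by omega)
  have a7 : poch q (c3*q^((M:ℤ)+1-(M-n:ℕ))) (M-n) ≠ 0 := Gn.poch hq g3 _ (M-n) rfl (by omega) (by omega)
  exact div_ne_zero (mul_ne_zero (mul_ne_zero a1 a2) a3)
    (mul_ne_zero (mul_ne_zero (mul_ne_zero a4 a5) a6) a7)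

lemma alpha_ne {q c0 c4 : ℂ} {N : ℕ} (hq : q ≠ 0)
    (g0 : Gn q c0 (2*N+5)) (g04 : Gn q (c0*c4) (2*N+5))
    (hq1 : ∀ k : ℕ, 1 ≤ k → k ≤ N → q ^ k ≠ 1) (j : ℕ) (hj : j ≤ N) :
    alpha q c0 c4 j j ≠ 0 := by
  exact div_ne_zero (mul_ne_zero (mul_ne_zero (poch_negN hq hq1 le_rfl hj)
    (Gn.poch hq g04 _ j rfl (by omega) (by omega))) (pow_ne_zero _ hq))
    (mul_ne_zero (Gn.poch hq g0 1 j (by rw [zpow_one]; ring) le_rfl (by omega)) (poch_qq hq1 hj))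

def Rp (q c1 c2 c3 : ℂ) (M i : ℕ) : MvPolynomial (Fin 2) ℂ :=
  ∑ m ∈ Finset.range (M-i+1), C (beta q c1 c2 c3 M i m) * (∏ l ∈ Finset.Ico m (M-i), 1) *
    ∏ l ∈ Finset.range m, aff 0 (fa q (c1*c2) l) (-q^l)

lemma Rp_deg {q c1 c2 c3 : ℂ} (hq : q ≠ 0) (M i : ℕ) (h : beta q c1 c2 c3 M i (M-i) ≠ 0) :
    (Rp q c1 c2 c3 M i).totalDegree = M - i := by
  refine deg_lemma (M-i) (beta q c1 c2 c3 M i) (fun _ => 1) (fun l => aff 0 (fa q (c1*c2) l) (-q^l)) ?_ ?_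
    ![Polynomial.X, 0] ?_ ?_ ?_ h
  · intro l; simp
  · intro l; exact aff_deg _ _ _
  · intro v; fin_cases v <;> simp
  · intro l; simp
  · intro l; rw [aff_aeval]; exact aff_natDeg _ _ (neg_ne_zero.2 (pow_ne_zero l hq))

lemma Rp_eval {q c1 c2 c3 : ℂ} (hq : q ≠ 0) (M i x : ℕ) (v : ℂ) :
    eval ![lam q (c1*c2) x, v] (Rp q c1 c2 c3 M i) = ∑ m ∈ Finset.range (M-i+1), beta q c1 c2 c3 M i m *
      (poch q (q^(-(x:ℤ))) m * poch q (c1*c2*q^((x:ℤ)+1)) m) := by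
  rw [Rp, map_sum]
  apply Finset.sum_congr rfl
  intro m _
  rw [phi_eq hq (c1*c2) x m]
  simp [aff, map_prod]

def Qp (q cc d c0 c4 : ℂ) (N j : ℕ) : MvPolynomial (Fin 2) ℂ :=
  ∑ k ∈ Finset.range (j+1), C (alpha q c0 c4 j k) *
    (∏ l ∈ Finset.Ico k j, aff 0 (xa q cc N l) (-(q^l*(q^N*q*cc)⁻¹))) *
    ∏ l ∈ Finset.range k, aff 1 (fa q d l) (-q^l)

lemma Qp_deg {q cc d c0 c4 : ℂ} (hq : q ≠ 0) (N j : ℕ) (h : alpha q c0 c4 j j ≠ 0) :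
    (Qp q cc d c0 c4 N j).totalDegree = j := by
  refine deg_lemma j (alpha q c0 c4 j) (fun l => aff 0 (xa q cc N l) (-(q^l*(q^N*q*cc)⁻¹)))
    (fun l => aff 1 (fa q d l) (-q^l)) ?_ ?_
    ![0, Polynomial.X] ?_ ?_ ?_ h
  · intro l; exact aff_deg _ _ _
  · intro l; exact aff_deg _ _ _
  · intro v; fin_cases v <;> simp
  · intro l; rw [aff_aeval]; simp
  · intro l; rw [aff_aeval]; exact aff_natDeg _ _ (neg_ne_zero.2 (pow_ne_zero l hq))

lemma Qp_eval {q cc d c0 c4 D : ℂ} (hq : q ≠ 0) (hc : cc ≠ 0) (N j x y : ℕ) (hx : x ≤ N)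
    (hD : D = q ^ (-((N:ℤ)+1+x)) / cc) :
    eval ![lam q cc x, lam q d y] (Qp q cc d c0 c4 N j) = ∑ k ∈ Finset.range (j+1), alpha q c0 c4 j k *
        (∏ l ∈ Finset.Ico k j, ((1 - q ^ (-((N-x:ℕ):ℤ)) * q^l) * (1 - D * q^l))) *
        (poch q (q^(-(y:ℤ))) k * poch q (d*q^((y:ℤ)+1)) k) := by
  rw [Qp, map_sum]
  apply Finset.sum_congr rfl
  intro k _
  rw [phi_eq hq d y k, Finset.prod_congr rfl (fun l _ => xfac_eq hq hc N x l hx hD)]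
  simp [aff, map_prod]

lemma Qp_zero {q cc d c0 c4 : ℂ} (hq : q ≠ 0) (hc : cc ≠ 0) (N j x y : ℕ) (hxy : x + y ≤ N)
    (hj : N < x + j) :
    eval ![lam q cc x, lam q d y] (Qp q cc d c0 c4 N j) = 0 := by
  rw [Qp_eval hq hc N j x y (by omega) rfl]
  apply Finset.sum_eq_zero
  intro k _
  by_cases hk : k ≤ N - x
  · rw [Finset.prod_eq_zero (i := N - x)]
    · ring
    · rw [Finset.mem_Ico]; omega
    · rw [zpow_neg, zpow_natCast, inv_mul_cancel₀ (pow_ne_zero _ hq)]; ring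
  · rw [poch_neg_zero hq (by omega : y < k)]; ring

end qR

/-- Polynomiality of the Tratnik polynomials of q-Racah type. -/
theorem tratnik_polynomiality
    (N : ℕ) (q s c1 c2 c3 c4 c0 t1 t2 t3 t4 t0 : ℂ)
    (hq : q ≠ 0) (hc1 : c1 ≠ 0) (hc2 : c2 ≠ 0) (hc3 : c3 ≠ 0) (hc4 : c4 ≠ 0)
    (hs : s ^ 2 = q) (ht1 : t1 ^ 2 = c1) (ht2 : t2 ^ 2 = c2) (ht3 : t3 ^ 2 = c3)
    (ht4 : t4 ^ 2 = c4)
    (hc0 : c0 = (q ^ (2 * (N : ℤ) + 3) * c1 * c2 * c3 * c4)⁻¹)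
    (ht0 : t0 = (s ^ (2 * (N : ℤ) + 3) * t1 * t2 * t3 * t4)⁻¹)
    (hgen : ∀ e0 e1 e2 e3 e4 : ℕ, e0 ≤ 1 → e1 ≤ 1 → e2 ≤ 1 → e3 ≤ 1 → e4 ≤ 1 →
      1 ≤ e0 + e1 + e2 + e3 + e4 → e0 + e1 + e2 + e3 + e4 ≤ 4 →
      ∀ k : ℤ, 1 ≤ k → k ≤ 2 * (N : ℤ) + 5 →
        c0 ^ e0 * c1 ^ e1 * c2 ^ e2 * c3 ^ e3 * c4 ^ e4 ≠ q ^ (-k))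
    (hq1 : ∀ k : ℕ, 1 ≤ k → k ≤ N → q ^ k ≠ 1)
    (i j : ℕ) (hij : i + j ≤ N) :
    ∃ P : MvPolynomial (Fin 2) ℂ, P.totalDegree = N - i ∧
      ∀ x y : ℕ, x + y ≤ N →
        ((-1 : ℂ) ^ N * (t1 / t4) ^ N * qR.xi q c2 (c2 * c3 * q ^ N) t2 (t2 * t3 * s ^ N) (N : ℤ)
              * (t4 / t3) ^ x * qR.xi q c1 c2 t1 t2 (x : ℤ) ≠ 0)
          ∧
        qR.T q s c1 c2 c3 c4 t1 t2 t3 t4 (N : ℤ) (i : ℤ) (j : ℤ) (x : ℤ) (y : ℤ)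
          = (-1 : ℂ) ^ N * (t1 / t4) ^ N
              * qR.xi q c2 (c2 * c3 * q ^ N) t2 (t2 * t3 * s ^ N) (N : ℤ)
              * (t4 / t3) ^ x * qR.xi q c1 c2 t1 t2 (x : ℤ)
              * MvPolynomial.eval ![qR.lam q (c1 * c2) (x : ℤ), qR.lam q (c3 * c0) (y : ℤ)] P := by
  have G : ∀ e0 e1 e2 e3 e4 : ℕ, e0 ≤ 1 → e1 ≤ 1 → e2 ≤ 1 → e3 ≤ 1 → e4 ≤ 1 →
      1 ≤ e0 + e1 + e2 + e3 + e4 → e0 + e1 + e2 + e3 + e4 ≤ 4 →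
      qR.Gn q (c0 ^ e0 * c1 ^ e1 * c2 ^ e2 * c3 ^ e3 * c4 ^ e4) (2*N+5) :=
    fun e0 e1 e2 e3 e4 h0 h1 h2 h3 h4 h5 h6 k hk hk' => hgen e0 e1 e2 e3 e4 h0 h1 h2 h3 h4 h5 h6 k hk hk'
  have g0 : qR.Gn q c0 (2*N+5) := by simpa using G 1 0 0 0 0
  have g1 : qR.Gn q c1 (2*N+5) := by simpa using G 0 1 0 0 0
  have g2 : qR.Gn q c2 (2*N+5) := by simpa using G 0 0 1 0 0
  have g3 : qR.Gn q c3 (2*N+5) := by simpa using G 0 0 0 1 0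
  have g4 : qR.Gn q c4 (2*N+5) := by simpa using G 0 0 0 0 1
  have g23 : qR.Gn q (c2*c3) (2*N+5) := by simpa using G 0 0 1 1 0
  have g04 : qR.Gn q (c0*c4) (2*N+5) := by simpa using G 1 0 0 0 1
  have g123 : qR.Gn q (c1*c2*c3) (2*N+5) := by simpa using G 0 1 1 1 0
  have g12 : qR.Gn q (c1*c2) (2*N+5) := by simpa using G 0 1 1 0 0
  have g034 : qR.Gn q (c0*c3*c4) (2*N+5) := by simpa using G 1 0 0 1 1
  clear G hgen
  have hs0 : s ≠ 0 := by rintro rfl; exact hq (by rw [← hs]; ring)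
  have ht1' : t1 ≠ 0 := by rintro rfl; exact hc1 (by rw [← ht1]; ring)
  have ht2' : t2 ≠ 0 := by rintro rfl; exact hc2 (by rw [← ht2]; ring)
  have ht3' : t3 ≠ 0 := by rintro rfl; exact hc3 (by rw [← ht3]; ring)
  have ht4' : t4 ≠ 0 := by rintro rfl; exact hc4 (by rw [← ht4]; ring)
  have hst0 : s * t0 ≠ 0 := by
    rw [ht0]
    exact mul_ne_zero hs0 (inv_ne_zero (mul_ne_zero (mul_ne_zero (mul_ne_zero
      (mul_ne_zero (zpow_ne_zero _ hs0) ht1') ht2') ht3') ht4'))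
  have hc0' : c0 ≠ 0 := by
    rw [hc0]
    exact (inv_ne_zero (mul_ne_zero (mul_ne_zero (mul_ne_zero
      (mul_ne_zero (zpow_ne_zero _ hq) hc1) hc2) hc3) hc4))
  have P1 : ∀ {c : ℂ} (n : ℕ), qR.Gn q c (2*N+5) → n ≤ N → qR.poch q (q*c) n ≠ 0 :=
    fun n g hn => qR.Gn.poch hq g 1 n (by rw [zpow_one]; ring) le_rfl (by omega)
  have L1 : ∀ {c : ℂ} (a : ℤ), qR.Gn q c (2*N+5) → 1 ≤ a → a ≤ 2*N+5 → 1 - c*q^a ≠ 0 := by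
    intro c a g h h' h0
    apply g a h h'
    rw [zpow_neg]
    exact eq_inv_of_mul_eq_one_left (by linear_combination -h0)
  obtain ⟨M, hM⟩ : ∃ M, M + j = N := ⟨N - j, by omega⟩
  -- nonvanishing constant
  have hx23 : qR.xi q c2 (c2 * c3 * q ^ N) t2 (t2 * t3 * s ^ N) (N : ℤ) ≠ 0 := by
    rw [qR.xi, Int.toNat_natCast]
    refine mul_ne_zero (div_ne_zero (P1 N g2 le_rfl) ?_) (zpow_ne_zero _ (div_ne_zero (mul_ne_zero (mul_ne_zero ht2' ht3') (pow_ne_zero _ hs0)) ht2'))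
    exact qR.Gn.poch hq g23 (N+1) N (by rw [zpow_add₀ hq, zpow_natCast, zpow_one]; ring) (by omega) (by omega)
  have hCst : (-1 : ℂ) ^ N * (t1 / t4) ^ N * qR.xi q c2 (c2 * c3 * q ^ N) t2 (t2 * t3 * s ^ N) (N : ℤ) ≠ 0 :=
    mul_ne_zero (mul_ne_zero (pow_ne_zero _ (by norm_num)) (pow_ne_zero _ (div_ne_zero ht1' ht4'))) hx23
  generalize (-1 : ℂ) ^ N * (t1 / t4) ^ N * qR.xi q c2 (c2 * c3 * q ^ N) t2 (t2 * t3 * s ^ N) (N : ℤ) = Cst at hCst ⊢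
  have hxi : ∀ x : ℕ, x ≤ N → qR.xi q c1 c2 t1 t2 (x:ℤ) ≠ 0 := by
    intro x hx
    rw [qR.xi, Int.toNat_natCast]
    exact mul_ne_zero (div_ne_zero (P1 x g1 hx) (P1 x g2 hx)) (zpow_ne_zero _ (div_ne_zero ht2' ht1'))
  have hbin : ∀ L n : ℕ, n ≤ L → L ≤ N → qR.binom q (L:ℤ) (n:ℤ) ≠ 0 := by
    intro L n h1 h2
    rw [qR.binom, if_pos (by omega)]
    exact div_ne_zero (qR.poch_qq hq1 (by omega)) (mul_ne_zero (qR.poch_qq hq1 (by omega)) (qR.poch_qq hq1 (by omega)))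
  have hOm : qR.Om q s c1 c2 c3 t2 (M:ℤ) (i:ℤ) ≠ 0 := by
    rw [qR.Om]
    refine div_ne_zero (mul_ne_zero (mul_ne_zero (mul_ne_zero (mul_ne_zero (hbin _ _ (by omega) (by omega)) (L1 _ g23 (by omega) (by omega)))
      (P1 _ g2 (by omega))) (qR.Gn.poch hq g123 _ _ rfl (by omega) (by omega))) (P1 _ g1 (by omega)))
      (mul_ne_zero (mul_ne_zero (zpow_ne_zero _ (mul_ne_zero hs0 ht2')) (qR.Gn.poch hq g23 _ _ rfl (by omega) (by omega))) (P1 _ g3 (by omega)))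
  have hw : qR.poch q (c0*c4*q^((j:ℤ)+1)) (N+1) ≠ 0 := qR.Gn.poch hq g04 _ _ rfl (by omega) (by omega)
  have hW : ∏ l ∈ Finset.range j, (-q^l) ≠ 0 :=
    Finset.prod_ne_zero_iff.2 (fun l _ => neg_ne_zero.2 (pow_ne_zero l hq))
  have hK0 : qR.poch q (q*c3) M * q^(N*j) / ((s*t0)^(2*(j:ℤ)-N) * qR.poch q (c0*c4*q^((j:ℤ)+1)) (N+1)) ≠ 0 :=
    div_ne_zero (mul_ne_zero (P1 _ g3 (by omega)) (pow_ne_zero _ hq)) (mul_ne_zero (zpow_ne_zero _ hst0) hw)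
  have hxid := fun x hx => qR.xid (x := x) hq hs hs0 hc2 ht1' ht2' ht3' ht4' ht1 ht2 ht3 ht4 N M j hM hx hc0 ht0 hw
    (qR.Gn.poch hq g123 _ _ rfl (by omega) (by omega)) (P1 _ g2 (by omega))
  generalize qR.poch q (q*c3) M * q^(N*j) / ((s*t0)^(2*(j:ℤ)-N) * qR.poch q (c0*c4*q^((j:ℤ)+1)) (N+1)) = K0 at hK0 hxid
  have hlin : 1 - c0*c4*q^(2*(j:ℤ)+1) ≠ 0 := L1 _ g04 (by omega) (by omega)
  have h0j : qR.poch q (q*c0) j ≠ 0 := P1 _ g0 (by omega)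
  have h4j : qR.poch q (q*c4) j ≠ 0 := P1 _ g4 (by omega)
  have hqj : qR.poch q q j ≠ 0 := qR.poch_qq hq1 (by omega)
  have hR := qR.Rp_deg hq M i (qR.beta_ne (N := N) hq hc2 hc3 g1 g23 g3 hq1 M i (by omega) (by omega))
  have hQ := qR.Qp_deg (cc := c1*c2) (d := c3*c0) hq N j (qR.alpha_ne (N := N) hq g0 g04 hq1 j (by omega))
  have hRne : qR.Rp q c1 c2 c3 M i ≠ 0 := by
    intro h
    have := qR.Rp_eval (c1 := c1) (c2 := c2) (c3 := c3) hq M i 0 0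
    rw [h, map_zero, Finset.sum_eq_single 0] at this
    · simp [qR.beta, qR.poch_zero] at this
    · intro b _ hb
      rw [qR.poch_neg_zero hq (by omega)]; ring
    · simp
  have hKne : (qR.Om q s c1 c2 c3 t2 (M:ℤ) (i:ℤ) * (1 - c0*c4*q^(2*(j:ℤ)+1)) * qR.poch q (q*c0) j * K0 /
    (qR.poch q (q*c4) j * (qR.poch q q j * ∏ l ∈ Finset.range j, (-q^l)) * Cst)) ≠ 0 :=
    div_ne_zero (mul_ne_zero (mul_ne_zero (mul_ne_zero hOm hlin) h0j) hK0) (mul_ne_zero (mul_ne_zero h4j (mul_ne_zero hqj hW)) hCst)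
  refine ⟨MvPolynomial.C (qR.Om q s c1 c2 c3 t2 (M:ℤ) (i:ℤ) * (1 - c0*c4*q^(2*(j:ℤ)+1)) * qR.poch q (q*c0) j * K0 /
    (qR.poch q (q*c4) j * (qR.poch q q j * ∏ l ∈ Finset.range j, (-q^l)) * Cst))
    * (qR.Rp q c1 c2 c3 M i * qR.Qp q (c1*c2) (c3*c0) c0 c4 N j), ?_, ?_⟩
  · by_cases hQ0 : qR.Qp q (c1*c2) (c3*c0) c0 c4 N j = 0
    · exfalso
      have hjj : j = 0 := by rw [hQ0] at hQ; simpa using hQ.symm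
      subst hjj
      simp [qR.Qp, qR.alpha, qR.poch_zero] at hQ0
    · rw [MvPolynomial.totalDegree_mul_of_isDomain (by simpa using hKne) (mul_ne_zero hRne hQ0),
        MvPolynomial.totalDegree_mul_of_isDomain hRne hQ0, MvPolynomial.totalDegree_C, hR, hQ]
      omega
  intro x y hxy
  refine ⟨mul_ne_zero (mul_ne_zero hCst (pow_ne_zero _ (div_ne_zero ht4' ht3'))) (hxi x (by omega)), ?_⟩
  rw [map_mul, map_mul, MvPolynomial.eval_C]
  rw [qR.T, if_pos (by omega), ← hc0, ← ht0, show (N:ℤ) - j = (M:ℤ) by omega]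
  by_cases hx : x ≤ M
  · obtain ⟨L, hL⟩ : ∃ L, L = N - x := ⟨_, rfl⟩
    have hhM : ∀ k : ℕ, 1 ≤ k → k ≤ M → q ^ k ≠ 1 := fun k h h' => hq1 k h (by omega)
    have hhL : ∀ k : ℕ, 1 ≤ k → k ≤ L → q ^ k ≠ 1 := fun k h h' => hq1 k h (by omega)
    have hDD : c3*c0*c4*q^((L:ℤ)+2) = q ^ (-((N:ℤ)+1+x)) / (c1*c2) := by
      rw [hc0, hL, Nat.cast_sub (by omega), show -((N:ℤ)+1+x) = ((N:ℤ)-x+2) - (2*N+3) by ring, zpow_sub₀ hq ((N:ℤ)-x+2)]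
      have := zpow_ne_zero (2*(N:ℤ)+3) hq
      generalize q^(2*(N:ℤ)+3) = a at *
      generalize q^((N:ℤ)-x+2) = b at *
      field_simp
    have hDne : qR.poch q (c3*c0*c4*q^((L:ℤ)+2)) j ≠ 0 :=
      qR.Gn.poch hq g034 _ _ (by ring) (by omega) (by omega)
    rw [show (N:ℤ) - x = (L:ℤ) by omega]
    rw [qR.p, if_pos (by omega), qR.p, if_pos (by omega), Int.toNat_natCast, Int.toNat_natCast]
    rw [qR.searsB hq hs hc2 hc3 M i x hx (by omega) hhM
      (qR.Gn.poch hq g123 _ _ rfl (by omega) (by omega)) (P1 _ g1 (by omega)) (P1 _ g2 (by omega))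
      (fun m hm => qR.Gn.poch hq g3 _ _ rfl (by omega) (by omega))]
    have hp2 := qR.p2sum (c0 := c0) (c4 := c4) hq L j (fun k => qR.poch q (q^(-(y:ℤ))) k)
      (fun k => qR.poch q (c3*c0*q^((y:ℤ)+1)) k) (by omega) hhL hDne
    have hqe := qR.Qp_eval (d := c3*c0) (c0 := c0) (c4 := c4) hq (mul_ne_zero hc1 hc2) N j x y (by omega) hDD
    rw [← hL] at hqe
    rw [← hqe] at hp2
    rw [← qR.Rp_eval (v := qR.lam q (c3*c0) y) hq M i x]
    have hOm2 : qR.Om q s c3 c0 c4 t0 (L:ℤ) (j:ℤ) = (qR.binom q (L:ℤ) (j:ℤ) * qR.poch q (c3*c0*c4*q^((L:ℤ)+2)) j) *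
      ((1 - c0*c4*q^(2*(j:ℤ)+1)) * qR.poch q (q*c0) j / qR.poch q (q*c4) j) *
      (qR.poch q (q*c3) (M-x) / ((s*t0)^(2*(j:ℤ)-((N-x:ℕ):ℤ)) * qR.poch q (c0*c4*q^((j:ℤ)+1)) (N-x+1))) := by
      rw [qR.Om, Int.toNat_natCast, show ((L:ℤ)-j).toNat = M - x by omega, show ((L:ℤ)+1).toNat = N-x+1 by omega, ← hL]
      ring
    have hxx := hxid x hx
    have hxie : qR.xi q c1 c2 t1 t2 (x:ℤ) = qR.poch q (q*c1) x / qR.poch q (q*c2) x * (t2/t1)^x := by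
      rw [qR.xi, Int.toNat_natCast, zpow_natCast]
    rw [hOm2, hxie]
    rw [← hL] at hxx ⊢
    generalize (qR.poch q (q*c3) (M-x) / ((s*t0)^(2*(j:ℤ)-(L:ℤ)) * qR.poch q (c0*c4*q^((j:ℤ)+1)) (L+1))) = a1 at *
    generalize qR.poch q (q*c1) x / qR.poch q (q*c2) x * (t2/t1)^x = a2 at *
    generalize qR.poch q (c3*q^((M:ℤ)+1-x)) x * qR.poch q (q*c1) x * (-c2)^x * s^((x:ℤ)*(x+1)) /
        (qR.poch q (c1*c2*c3*q^((M:ℤ)+2)) x * qR.poch q (q*c2) x) = a3 at *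
    generalize (∑ k ∈ Finset.range (j+1), _ : ℂ) = S at *
    generalize MvPolynomial.eval _ (qR.Rp q c1 c2 c3 M i) = a4 at *
    generalize MvPolynomial.eval _ (qR.Qp q (c1*c2) (c3*c0) c0 c4 N j) = a5 at *
    generalize qR.binom q (L:ℤ) (j:ℤ) * qR.poch q (c3*c0*c4*q^((L:ℤ)+2)) j = a6 at *
    generalize ∏ l ∈ Finset.range j, (-q^l) = a7 at *
    generalize qR.Om q s c1 c2 c3 t2 (M:ℤ) (i:ℤ) = a9 at *
    generalize 1 - c0*c4*q^(2*(j:ℤ)+1) = b1 at *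
    generalize qR.poch q (q*c0) j = b2 at *
    generalize qR.poch q (q*c4) j = b3 at *
    generalize qR.poch q q j = b4 at *
    generalize (t4/t3)^x = b5 at *
    generalize q^(L*j) = b6 at *
    have e : Cst * b5 * a2 * (a9*b1*b2*K0/(b3*(b4*a7)*Cst)*(a4*a5))
        = a9*b1*b2/b3*a4*a5/(b4*a7)*(K0*(b5*a2)) := by field_simp
    rw [e, ← hxx]
    linear_combination a9*a3*a4*(b1*b2/b3)*a1*hp2
  · rw [qR.p, if_neg (by omega), qR.Qp_zero hq (mul_ne_zero hc1 hc2) N j x y hxy (by omega)]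
    ring
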